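/- Let M̄ be an admissible completion as a point set of (M,≪). Any topology τ on M̄ which satisfies the admissibility conditions (A1) and (A2) is T1 (every singleton is closed). -/

import Mathlib

open Filter Set Topology

variable {M : Type*}

/-- The chronological past `I⁻(p)` of a point. -/
def IPast (r : M → M → Prop) (p : M) : Set M := {q | r q p}

/-- The chronological future `I⁺(p)` of a point. -/
def IFut (r : M → M → Prop) (p : M) : Set M := {q | r p q}

/-- The chronological past `I⁻[S]` of a set. -/
def IPastS (r : M → M → Prop) (S : Set M) : Set M := ⋃ s ∈ S, IPast r s

/-- The chronological future `I⁺[S]` of a set. -/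
def IFutS (r : M → M → Prop) (S : Set M) : Set M := ⋃ s ∈ S, IFut r s

/-- A past set: `P = I⁻[P]`. -/
def IsPastSet (r : M → M → Prop) (P : Set M) : Prop := P = IPastS r P

/-- A future set: `F = I⁺[F]`. -/
def IsFutSet (r : M → M → Prop) (F : Set M) : Prop := F = IFutS r F

/-- An indecomposable past set (IP). -/
def IsIP (r : M → M → Prop) (P : Set M) : Prop :=
  P.Nonempty ∧ IsPastSet r P ∧
    ¬∃ P₁ P₂ : Set M, IsPastSet r P₁ ∧ IsPastSet r P₂ ∧ P₁ ⊂ P ∧ P₂ ⊂ P ∧ P = P₁ ∪ P₂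

/-- An indecomposable future set (IF). -/
def IsIF (r : M → M → Prop) (F : Set M) : Prop :=
  F.Nonempty ∧ IsFutSet r F ∧
    ¬∃ F₁ F₂ : Set M, IsFutSet r F₁ ∧ IsFutSet r F₂ ∧ F₁ ⊂ F ∧ F₂ ⊂ F ∧ F = F₁ ∪ F₂

/-- A terminal IP (TIP): an IP which is not of the form `I⁻(p)`. -/
def IsTIP (r : M → M → Prop) (P : Set M) : Prop := IsIP r P ∧ ∀ p : M, P ≠ IPast r p

/-- A terminal IF (TIF). -/
def IsTIF (r : M → M → Prop) (F : Set M) : Prop := IsIF r F ∧ ∀ p : M, F ≠ IFut r p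

/-- The common future `↑P`. -/
def commonFut (r : M → M → Prop) (P : Set M) : Set M := IFutS r {q | ∀ p ∈ P, r p q}

/-- The common past `↓F`. -/
def commonPast (r : M → M → Prop) (F : Set M) : Set M := IPastS r {q | ∀ p ∈ F, r q p}

/-- `P` is a maximal IP contained in `S`. -/
def MaxIPIn (r : M → M → Prop) (P S : Set M) : Prop :=
  IsIP r P ∧ P ⊆ S ∧ ∀ P', IsIP r P' → P' ⊆ S → P ⊆ P' → P = P'

/-- `F` is a maximal IF contained in `S`. -/
def MaxIFIn (r : M → M → Prop) (F S : Set M) : Prop :=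
  IsIF r F ∧ F ⊆ S ∧ ∀ F', IsIF r F' → F' ⊆ S → F ⊆ F' → F = F'

/-- The Szabados relation between (nonempty) indecomposable sets: `F` is a maximal IF
contained in `↑P` and `P` is a maximal IP contained in `↓F`. -/
def SRelNE (r : M → M → Prop) (P F : Set M) : Prop :=
  MaxIFIn r F (commonFut r P) ∧ MaxIPIn r P (commonPast r F)

/-- The full S-relation, allowing one empty component. -/
def SRel (r : M → M → Prop) (P F : Set M) : Prop :=
  SRelNE r P F ∨
    (F = ∅ ∧ IsIP r P ∧ ∀ F', IsIF r F' → ¬SRelNE r P F') ∨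
    (P = ∅ ∧ IsIF r F ∧ ∀ P', IsIP r P' → ¬SRelNE r P' F)

/-- The embedding `i(p) = (I⁻(p), I⁺(p))`. -/
def chrEmb (r : M → M → Prop) (p : M) : Set M × Set M := (IPast r p, IFut r p)

/-- The image `i(M)` inside the set of pairs. -/
def imgM (r : M → M → Prop) : Set (Set M × Set M) := Set.range (chrEmb r)

/-- An admissible completion as a point set. -/
structure IsAdmissibleCompletion (r : M → M → Prop) (Mb : Set (Set M × Set M)) : Prop where
  mem_point : ∀ p : M, chrEmb r p ∈ Mb
  complete_TIP : ∀ P : Set M, IsTIP r P → ∃ x ∈ Mb \ imgM r, x.1 = P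
  complete_TIF : ∀ F : Set M, IsTIF r F → ∃ x ∈ Mb \ imgM r, x.2 = F
  srel : ∀ x ∈ Mb, SRel r x.1 x.2

/-- The extended chronological relation `(P,F) ≪̄ (P',F') ↔ F ∩ P' ≠ ∅`. -/
def extChron (x y : Set M × Set M) : Prop := (x.2 ∩ y.1).Nonempty

/-- A chronology: a transitive and anti-reflexive binary relation. -/
def IsChronology (r : M → M → Prop) : Prop := Transitive r ∧ Irreflexive r

/-- A chronological set: a chronology with no isolates which is chronologically separable. -/
def IsChronologicalSet (r : M → M → Prop) : Prop :=
  IsChronology r ∧ (∀ x, ∃ y, r x y ∨ r y x) ∧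
    ∃ S : Set M, S.Countable ∧ ∀ x y, r x y → ∃ s ∈ S, r x s ∧ r s y
/-- The chronological future of a point of the completion, inside the completion,
with respect to the extended chronological relation. -/
def futIn (Mb : Set (Set M × Set M)) (x : ↥Mb) : Set ↥Mb :=
  {y | extChron (x : Set M × Set M) (y : Set M × Set M)}

/-- The chronological past of a point of the completion, inside the completion. -/
def pastIn (Mb : Set (Set M × Set M)) (x : ↥Mb) : Set ↥Mb :=
  {y | extChron (y : Set M × Set M) (x : Set M × Set M)}

/-- CEAT: the coarsest topology on the completion in which all the sets `I⁺((P,F))`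
and `I⁻((P,F))` are open. -/
def CEAT (Mb : Set (Set M × Set M)) : TopologicalSpace ↥Mb :=
  TopologicalSpace.generateFrom
    ({S | ∃ x : ↥Mb, S = futIn Mb x} ∪ {S | ∃ x : ↥Mb, S = pastIn Mb x})

/-- The set-theoretic inferior limit of a sequence of sets. -/
def setLI (A : ℕ → Set M) : Set M := {x | ∀ᶠ n in Filter.atTop, x ∈ A n}

/-- The set-theoretic superior limit of a sequence of sets. -/
def setLS (A : ℕ → Set M) : Set M := {x | ∃ᶠ n in Filter.atTop, x ∈ A n}

/-- The chronological limit operator (on pairs). -/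
def chrLim (r : M → M → Prop) (σ : ℕ → Set M × Set M) (x : Set M × Set M) : Prop :=
  (x.1 ≠ ∅ → x.1 ⊆ setLI (fun n => (σ n).1) ∧ MaxIPIn r x.1 (setLS fun n => (σ n).1)) ∧
  (x.2 ≠ ∅ → x.2 ⊆ setLI (fun n => (σ n).2) ∧ MaxIFIn r x.2 (setLS fun n => (σ n).2))

/-- The topology derived from a limit operator: closed sets are those containing all the
`L`-limits of their sequences. -/
def derivedTop {X : Type*} (L : (ℕ → X) → Set X)
    (hL : ∀ (σ : ℕ → X) (φ : ℕ → ℕ), StrictMono φ → L σ ⊆ L (σ ∘ φ)) :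
    TopologicalSpace X where
  IsOpen U := ∀ σ : ℕ → X, (∀ n, σ n ∈ Uᶜ) → L σ ⊆ Uᶜ
  isOpen_univ := by
    intro σ h
    simpa using h 0
  isOpen_inter := by
    intro U V hU hV σ hσ x hx
    have h : ∀ n, σ n ∈ Uᶜ ∨ σ n ∈ Vᶜ := by
      intro n
      have h' := hσ n
      rw [Set.compl_inter] at h'
      exact h'
    have hfreq : (∃ᶠ n in Filter.atTop, σ n ∈ Uᶜ) ∨ ∃ᶠ n in Filter.atTop, σ n ∈ Vᶜ :=
      Filter.frequently_or_distrib.mp (Filter.Frequently.of_forall h)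
    rw [Set.compl_inter]
    rcases hfreq with hf | hf
    · obtain ⟨φ, hφ, hmem⟩ := Filter.extraction_of_frequently_atTop hf
      exact Or.inl (hU (σ ∘ φ) hmem (hL σ φ hφ hx))
    · obtain ⟨φ, hφ, hmem⟩ := Filter.extraction_of_frequently_atTop hf
      exact Or.inr (hV (σ ∘ φ) hmem (hL σ φ hφ hx))
  isOpen_sUnion := by
    intro S hS σ hσ x hx
    intro hmem
    rcases hmem with ⟨U, hU, hxU⟩
    exact hS U hU σ (fun n h => hσ n ⟨U, hU, h⟩) hx hxU

lemma setLI_subseq {A : ℕ → Set M} {φ : ℕ → ℕ} (hφ : StrictMono φ) :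
    setLI A ⊆ setLI fun n => A (φ n) :=
  fun _ hx => hφ.tendsto_atTop.eventually hx

lemma setLS_subseq {A : ℕ → Set M} {φ : ℕ → ℕ} (hφ : StrictMono φ) :
    (setLS fun n => A (φ n)) ⊆ setLS A :=
  fun _ hx => hφ.tendsto_atTop.frequently hx

/-- The chronological limit operator on the completion. -/
def chrL (r : M → M → Prop) (Mb : Set (Set M × Set M)) (σ : ℕ → ↥Mb) : Set ↥Mb :=
  {x | chrLim r (fun n => ((σ n : Set M × Set M))) (x : Set M × Set M)}

lemma chrL_subseq (r : M → M → Prop) (Mb : Set (Set M × Set M)) :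
    ∀ (σ : ℕ → ↥Mb) (φ : ℕ → ℕ), StrictMono φ → chrL r Mb σ ⊆ chrL r Mb (σ ∘ φ) := by
  intro σ φ hφ x hx
  obtain ⟨h1, h2⟩ := hx
  constructor
  · intro hne
    obtain ⟨hli, hmax⟩ := h1 hne
    exact ⟨fun y hy => setLI_subseq hφ (hli hy), hmax.1,
      fun y hy => Filter.Eventually.frequently (setLI_subseq hφ (hli hy)),
      fun P' hP' hP'sub hsub => hmax.2.2 P' hP' (fun y hy => setLS_subseq hφ (hP'sub hy)) hsub⟩
  · intro hne
    obtain ⟨hli, hmax⟩ := h2 hne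
    exact ⟨fun y hy => setLI_subseq hφ (hli hy), hmax.1,
      fun y hy => Filter.Eventually.frequently (setLI_subseq hφ (hli hy)),
      fun F' hF' hF'sub hsub => hmax.2.2 F' hF' (fun y hy => setLS_subseq hφ (hF'sub hy)) hsub⟩

/-- The chronological topology on the completion. -/
def chrTop (r : M → M → Prop) (Mb : Set (Set M × Set M)) : TopologicalSpace ↥Mb :=
  derivedTop (chrL r Mb) (chrL_subseq r Mb)

/-- Admissibility condition (A1): chronological futures and pasts are open. -/
def CondA1 (Mb : Set (Set M × Set M)) (τ : TopologicalSpace ↥Mb) : Prop :=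
  ∀ x : ↥Mb, IsOpen[τ] (futIn Mb x) ∧ IsOpen[τ] (pastIn Mb x)

/-- Admissibility condition (A2). -/
def CondA2 (Mb : Set (Set M × Set M)) (τ : TopologicalSpace ↥Mb) : Prop :=
  (∀ (σ : ℕ → ↥Mb) (x : ↥Mb), Filter.Tendsto σ Filter.atTop (@nhds _ τ x) →
      (x : Set M × Set M).2 = ∅ →
      ∀ y : ↥Mb, (x : Set M × Set M).1 ⊆ (y : Set M × Set M).1 →
        (y : Set M × Set M).1 ⊆ setLI (fun n => ((σ n : Set M × Set M)).1) → y = x) ∧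
  (∀ (σ : ℕ → ↥Mb) (x : ↥Mb), Filter.Tendsto σ Filter.atTop (@nhds _ τ x) →
      (x : Set M × Set M).1 = ∅ →
      ∀ y : ↥Mb, (x : Set M × Set M).2 ⊆ (y : Set M × Set M).2 →
        (y : Set M × Set M).2 ⊆ setLI (fun n => ((σ n : Set M × Set M)).2) → y = x)

/-- Admissibility condition (A3): maximal coarseness among (A1)∧(A2) topologies. -/
def CondA3 (Mb : Set (Set M × Set M)) (τ : TopologicalSpace ↥Mb) : Prop :=
  ∀ τ' : TopologicalSpace ↥Mb, CondA1 Mb τ' → CondA2 Mb τ' → ¬(τ < τ')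

lemma isPastSet_empty (r : M → M → Prop) : IsPastSet r ∅ := by
  simp [IsPastSet, IPastS]

lemma isFutSet_empty (r : M → M → Prop) : IsFutSet r ∅ := by
  simp [IsFutSet, IFutS]

lemma IsPastSet.mem_iff {r : M → M → Prop} {P : Set M} (h : IsPastSet r P) {p : M} :
    p ∈ P ↔ (IFut r p ∩ P).Nonempty := by
  conv_lhs => rw [show P = IPastS r P from h]
  simp only [IPastS, IPast, IFut, mem_iUnion, mem_ofPred_eq, Set.Nonempty, mem_inter_iff]
  exact ⟨fun ⟨q, hq, hpq⟩ => ⟨q, hpq, hq⟩, fun ⟨q, hpq, hq⟩ => ⟨q, hq, hpq⟩⟩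

lemma IsFutSet.mem_iff {r : M → M → Prop} {F : Set M} (h : IsFutSet r F) {p : M} :
    p ∈ F ↔ (F ∩ IPast r p).Nonempty := by
  conv_lhs => rw [show F = IFutS r F from h]
  simp only [IFutS, IPast, IFut, mem_iUnion, mem_ofPred_eq, Set.Nonempty, mem_inter_iff,
    exists_prop]

lemma SRel.isPastSet {r : M → M → Prop} {P F : Set M} (h : SRel r P F) : IsPastSet r P := by
  rcases h with h | ⟨-, h, -⟩ | ⟨rfl, -, -⟩
  · exact h.2.1.2.1
  · exact h.2.1
  · exact isPastSet_empty r

lemma SRel.isFutSet {r : M → M → Prop} {P F : Set M} (h : SRel r P F) : IsFutSet r F := by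
  rcases h with h | ⟨rfl, -, -⟩ | ⟨-, h, -⟩
  · exact h.1.1.2.1
  · exact isFutSet_empty r
  · exact h.2.1

lemma SRel.sRelNE {r : M → M → Prop} {P F : Set M} (h : SRel r P F) (hP : P.Nonempty)
    (hF : F.Nonempty) : SRelNE r P F := by
  rcases h with h | ⟨h, -, -⟩ | ⟨h, -, -⟩
  · exact h
  · exact absurd h hF.ne_empty
  · exact absurd h hP.ne_empty

lemma commonFut_anti (r : M → M → Prop) {P P' : Set M} (h : P ⊆ P') :
    commonFut r P' ⊆ commonFut r P :=
  biUnion_subset_biUnion_left fun _ hq p hp => hq p (h hp)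

lemma commonPast_anti (r : M → M → Prop) {F F' : Set M} (h : F ⊆ F') :
    commonPast r F' ⊆ commonPast r F :=
  biUnion_subset_biUnion_left fun _ hq p hp => hq p (h hp)

/-- `S`-related pairs of nonempty sets are maximal for componentwise inclusion. -/
lemma SRelNE.eq_of_subset {r : M → M → Prop} {P F P' F' : Set M} (h : SRelNE r P F)
    (h' : SRelNE r P' F') (hP : P ⊆ P') (hF : F ⊆ F') : P = P' ∧ F = F' :=
  ⟨h.2.2.2 P' h'.2.1 (h'.2.2.1.trans (commonPast_anti r hF)) hP,
    h.1.2.2 F' h'.1.1 (h'.1.2.1.trans (commonFut_anti r hP)) hF⟩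

/-- If `x` lies in the closure of `{y}` for a topology satisfying (A1), then `x` is contained
componentwise in `y`. -/
lemma CondA1.subset_of_specializes {r : M → M → Prop} {Mb : Set (Set M × Set M)}
    (hMb : IsAdmissibleCompletion r Mb) {τ : TopologicalSpace ↥Mb} (hA1 : CondA1 Mb τ)
    {x y : ↥Mb} (h : y ⤳ x) : x.1.1 ⊆ y.1.1 ∧ x.1.2 ⊆ y.1.2 := by
  constructor
  · intro p hp
    exact (hMb.srel y y.2).isPastSet.mem_iff.2 <|
      h.mem_open (hA1 ⟨chrEmb r p, hMb.mem_point p⟩).1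
        ((hMb.srel x x.2).isPastSet.mem_iff.1 hp)
  · intro p hp
    exact (hMb.srel y y.2).isFutSet.mem_iff.2 <|
      h.mem_open (hA1 ⟨chrEmb r p, hMb.mem_point p⟩).2
        ((hMb.srel x x.2).isFutSet.mem_iff.1 hp)

/-- **Proposition.** Any topology on an admissible completion as a point set which satisfies
the admissibility conditions (A1) and (A2) is T1. -/
theorem t1_of_condA1_condA2
    (r : M → M → Prop) (hr : IsChronology r)
    (Mb : Set (Set M × Set M)) (hMb : IsAdmissibleCompletion r Mb)
    (τ : TopologicalSpace ↥Mb) (hA1 : CondA1 Mb τ) (hA2 : CondA2 Mb τ) :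
    @T1Space ↥Mb τ := by
  rw [t1Space_iff_specializes_imp_eq]
  intro y x h
  obtain ⟨hP, hF⟩ := hA1.subset_of_specializes hMb h
  have hlim : Tendsto (fun _ : ℕ => y) atTop (𝓝 x) :=
    tendsto_const_nhds.mono_right h
  rcases x.1.2.eq_empty_or_nonempty with hx2 | hx2
  · exact hA2.1 _ x hlim hx2 y hP fun _ hp => Eventually.of_forall fun _ => hp
  rcases x.1.1.eq_empty_or_nonempty with hx1 | hx1
  · exact hA2.2 _ x hlim hx1 y hF fun _ hp => Eventually.of_forall fun _ => hp
  obtain ⟨h1, h2⟩ := ((hMb.srel x x.2).sRelNE hx1 hx2).eq_of_subset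
    ((hMb.srel y y.2).sRelNE (hx1.mono hP) (hx2.mono hF)) hP hF
  exact Subtype.ext (Prod.ext h1.symm h2.symm)
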